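/- arXiv:1305.7100 — 2 statements merged into one kernel-verified Lean document; each statement's English description precedes it below -/
import Mathlib

section
/- Let H be a complex Hilbert space of dimension at least two, let r and s be nonnegative integers with r + s ≥ 1, and let A be a nonzero bounded linear operator on H. Then the following are equivalent: (1) A has rank one; (2) for every bounded linear operator B on H, σ_π(B^r A* B^s) is a singleton; (3) for every bounded linear operator B on H with rank(B) ≤ 2, σ_π(B^r A* B^s) is a singleton. -/
open scoped ENNReal

/-- The peripheral spectrum of a bounded linear operator on a complex Banach space:
the set of spectral values of maximal modulus. -/
noncomputable def periSpec {X : Type*} [NormedAddCommGroup X] [NormedSpace ℂ X]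
    (T : X →L[ℂ] X) : Set ℂ :=
  {z | z ∈ spectrum ℂ T ∧ (‖z‖₊ : ℝ≥0∞) = spectralRadius ℂ T}

open ContinuousLinearMap in
theorem exists_adjoint_eq_smulRight {H : Type*} [NormedAddCommGroup H]
    [InnerProductSpace ℂ H] [CompleteSpace H] {A : H →L[ℂ] H} {v : H}
    (hv : ∀ h, ∃ c : ℂ, A h = c • v) :
    ∃ (f : H →L[ℂ] ℂ) (w : H), adjoint A = f.smulRight w := by
  refine ⟨(inner ℂ v v)⁻¹ • innerSL ℂ v, adjoint A v, ?_⟩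
  ext y
  refine ext_inner_right ℂ fun h => ?_
  obtain ⟨c, hc⟩ := hv h
  rcases eq_or_ne v 0 with rfl | hv0
  · simp [adjoint_inner_left, hc]
  · have hvv : inner ℂ v v ≠ 0 := inner_self_ne_zero.2 hv0
    simp only [adjoint_inner_left, hc, inner_smul_right, smulRight_apply, smul_apply,
      innerSL_apply_apply, smul_eq_mul, inner_smul_left, map_mul, map_inv₀, inner_conj_symm]
    field_simp

theorem rank_eq_one_iff_forall_exists_smul {V : Type*} [AddCommGroup V] [Module ℂ V]
    {A : V →ₗ[ℂ] V} (hA : A ≠ 0) :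
    LinearMap.rank A = 1 ↔ ∃ v, ∀ h, ∃ c : ℂ, A h = c • v := by
  have hle : LinearMap.rank A ≤ 1 ↔ ∃ v, ∀ h, ∃ c : ℂ, A h = c • v := by
    rw [LinearMap.rank, rank_submodule_le_one_iff']
    refine exists_congr fun v => ⟨fun h x => ?_, ?_⟩
    · obtain ⟨c, hc⟩ := Submodule.mem_span_singleton.1 (h ⟨x, rfl⟩)
      exact ⟨c, hc.symm⟩
    · rintro h _ ⟨x, rfl⟩
      obtain ⟨c, hc⟩ := h x
      exact Submodule.mem_span_singleton.2 ⟨c, hc.symm⟩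
  rw [← hle]
  refine ⟨le_of_eq, fun h => le_antisymm h ?_⟩
  rw [Cardinal.one_le_iff_ne_zero, LinearMap.rank, Ne, Submodule.rank_eq_zero,
    LinearMap.range_eq_bot]
  exact hA

theorem mem_spectrum_of_apply_eq_smul {X : Type*} [NormedAddCommGroup X] [NormedSpace ℂ X]
    {T : X →L[ℂ] X} {z : ℂ} {v : X} (hv : v ≠ 0) (h : T v = z • v) : z ∈ spectrum ℂ T := by
  rw [spectrum.mem_iff]
  intro hu
  obtain ⟨S, hS⟩ := hu.exists_left_inv
  apply hv
  have := congrArg (fun R : X →L[ℂ] X => R v) hS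
  simpa [h, Algebra.algebraMap_eq_smul_one] using this.symm

theorem eval_eq_zero_of_mem_spectrum {X : Type*} [NormedAddCommGroup X] [NormedSpace ℂ X]
    [Nontrivial X] {T : X →L[ℂ] X} {p : Polynomial ℂ} (hp : Polynomial.aeval T p = 0) {z : ℂ}
    (hz : z ∈ spectrum ℂ T) : p.eval z = 0 := by
  have := spectrum.subset_polynomial_aeval T p ⟨z, hz, rfl⟩
  simpa [hp, spectrum.zero_eq] using this

theorem spectralRadius_eq_of_forall_le {X : Type*} [NormedAddCommGroup X] [NormedSpace ℂ X]
    {T : X →L[ℂ] X} {z : ℂ} (hz : z ∈ spectrum ℂ T) (h : ∀ w ∈ spectrum ℂ T, ‖w‖₊ ≤ ‖z‖₊) :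
    spectralRadius ℂ T = ‖z‖₊ :=
  le_antisymm (iSup₂_le fun w hw => by exact_mod_cast h w hw)
    (le_iSup₂ (f := fun w (_ : w ∈ spectrum ℂ T) => (‖w‖₊ : ℝ≥0∞)) z hz)

theorem periSpec_smulRight_eq_singleton {X : Type*} [NormedAddCommGroup X] [NormedSpace ℂ X]
    [CompleteSpace X] [Nontrivial X] (f : X →L[ℂ] ℂ) (u : X) :
    periSpec (f.smulRight u) = {f u} := by
  have hsub : ∀ z ∈ spectrum ℂ (f.smulRight u), z = 0 ∨ z = f u := by
    intro z hz
    have := eval_eq_zero_of_mem_spectrum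
      (p := Polynomial.X * (Polynomial.X - Polynomial.C (f u))) (by
        ext x
        simp [Algebra.algebraMap_eq_smul_one, mul_comm]) hz
    simpa [sub_eq_zero] using this
  have hmem : f u ∈ spectrum ℂ (f.smulRight u) := by
    by_cases hc : f u = 0
    · obtain ⟨z, hz⟩ := spectrum.nonempty (f.smulRight u)
      rcases hsub z hz with rfl | rfl
      · rwa [hc]
      · exact hz
    · refine mem_spectrum_of_apply_eq_smul (v := u) ?_ (by simp)
      rintro rfl
      simp at hc
  have hrad := spectralRadius_eq_of_forall_le hmem fun w hw => by
    rcases hsub w hw with rfl | rfl <;> simp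
  ext z
  simp only [periSpec, Set.mem_ofPred_eq, Set.mem_singleton_iff, hrad]
  refine ⟨fun ⟨hz, hn⟩ => ?_, fun h => by rw [h]; exact ⟨hmem, rfl⟩⟩
  rcases hsub z hz with rfl | rfl
  · exact (nnnorm_eq_zero.1 (by simpa using hn.symm)).symm
  · rfl

theorem inner_mul_inner_sub_ne_zero {H : Type*} [NormedAddCommGroup H]
    [InnerProductSpace ℂ H] {x y : H} (h : ∀ a b : ℂ, a • x + b • y = 0 → a = 0 ∧ b = 0) :
    inner ℂ x x * inner ℂ y y - inner ℂ x y * inner ℂ y x ≠ 0 := by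
  intro h0
  have hx : x ≠ 0 := by
    rintro rfl
    simpa using h 1 0 (by simp)
  have hxx : inner ℂ x x ≠ 0 := inner_self_ne_zero.2 hx
  have key : (-inner ℂ x y) • x + (inner ℂ x x) • y = 0 := by
    rw [← inner_self_eq_zero (𝕜 := ℂ)]
    simp only [inner_add_left, inner_add_right, inner_smul_left, inner_smul_right, map_neg,
      inner_conj_symm]
    linear_combination inner ℂ x x * h0
  exact hxx (h _ _ key).2

theorem exists_quadratics_ne_zero {a b c a' b' c' : ℂ} (ha : a ≠ 0) (hc : c' ≠ 0) :
    ∃ z : ℂ, a + b * z + c * z ^ 2 ≠ 0 ∧ a' + b' * z + c' * z ^ 2 ≠ 0 := by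
  open Polynomial in
  let p : ℂ[X] := C a + C b * X + C c * X ^ 2
  let q : ℂ[X] := C a' + C b' * X + C c' * X ^ 2
  have hp : p ≠ 0 := fun h => ha (by simpa [p] using congrArg (Polynomial.eval 0) h)
  have hq : q ≠ 0 := fun h => hc (by
    simpa [q, Polynomial.coeff_X, Polynomial.coeff_C] using
      congrArg (fun r => Polynomial.coeff r 2) h)
  have hpq : p * q ≠ 0 := mul_ne_zero hp hq
  by_contra! hcon
  refine hpq (Polynomial.funext fun z => ?_)
  by_cases h1 : a + b * z + c * z ^ 2 = 0
  · simp [p, q, h1]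
  · simp [p, q, hcon z h1]

/-- `u₁, u₂` and `f₁, f₂` are biorthogonal, and the compression of `T` to the span of `u₁, u₂`
they determine is invertible. -/
structure InvertibleCompression {X : Type*} [NormedAddCommGroup X] [NormedSpace ℂ X]
    (T : X →L[ℂ] X) (u₁ u₂ : X) (f₁ f₂ : X →L[ℂ] ℂ) : Prop where
  f₁u₁ : f₁ u₁ = 1
  f₁u₂ : f₁ u₂ = 0
  f₂u₁ : f₂ u₁ = 0
  f₂u₂ : f₂ u₂ = 1
  det_ne : f₁ (T u₁) * f₂ (T u₂) - f₁ (T u₂) * f₂ (T u₁) ≠ 0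

theorem exists_invertibleCompression {H : Type*} [NormedAddCommGroup H]
    [InnerProductSpace ℂ H] {T : H →L[ℂ] H} {x y : H}
    (h : ∀ a b : ℂ, a • T x + b • T y = 0 → a = 0 ∧ b = 0) :
    ∃ u₁ u₂ f₁ f₂, InvertibleCompression T u₁ u₂ f₁ f₂ := by
  have hxy : ∀ a b : ℂ, a • x + b • y = 0 → a = 0 ∧ b = 0 := fun a b hab =>
    h a b (by simpa using congrArg T hab)
  obtain ⟨z, h1, h2⟩ := exists_quadratics_ne_zero
    (a := inner ℂ x x * inner ℂ y y - inner ℂ x y * inner ℂ y x)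
    (b := inner ℂ (T x) x * inner ℂ y y + inner ℂ x x * inner ℂ (T y) y
      - inner ℂ (T x) y * inner ℂ y x - inner ℂ x y * inner ℂ (T y) x)
    (c := inner ℂ (T x) x * inner ℂ (T y) y - inner ℂ (T x) y * inner ℂ (T y) x)
    (a' := inner ℂ x (T x) * inner ℂ y (T y) - inner ℂ x (T y) * inner ℂ y (T x))
    (b' := inner ℂ (T x) (T x) * inner ℂ y (T y) + inner ℂ x (T x) * inner ℂ (T y) (T y)
      - inner ℂ (T x) (T y) * inner ℂ y (T x) - inner ℂ x (T y) * inner ℂ (T y) (T x))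
    (c' := inner ℂ (T x) (T x) * inner ℂ (T y) (T y) - inner ℂ (T x) (T y) * inner ℂ (T y) (T x))
    (inner_mul_inner_sub_ne_zero hxy) (inner_mul_inner_sub_ne_zero h)
  set f : H →L[ℂ] ℂ := innerSL ℂ x + z • innerSL ℂ (T x) with hf
  set g : H →L[ℂ] ℂ := innerSL ℂ y + z • innerSL ℂ (T y) with hg
  have hD : f x * g y - f y * g x ≠ 0 := by
    convert h1 using 1
    simp [hf, hg]
    ring
  have hE : f (T x) * g (T y) - f (T y) * g (T x) ≠ 0 := by
    convert h2 using 1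
    simp [hf, hg]
    ring
  clear_value f g
  set D := f x * g y - f y * g x with hDdef
  refine ⟨x, y, D⁻¹ • (g y • f - f y • g), D⁻¹ • (f x • g - g x • f), ?_, ?_, ?_, ?_, ?_⟩
  · simp only [smul_apply, sub_apply, smul_eq_mul]
    rw [inv_mul_eq_one₀ hD, hDdef]
    ring
  · simp
    right
    ring
  · simp
    right
    ring
  · simp only [smul_apply, sub_apply, smul_eq_mul]
    rw [inv_mul_eq_one₀ hD, hDdef]
    ring
  · convert mul_ne_zero (inv_ne_zero hD) hE using 1
    simp only [smul_apply, sub_apply, smul_eq_mul]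
    field_simp
    rw [hDdef]
    ring

namespace InvertibleCompression

variable {X : Type*} [NormedAddCommGroup X] [NormedSpace ℂ X] {T : X →L[ℂ] X} {u₁ u₂ : X}
  {f₁ f₂ : X →L[ℂ] ℂ}

theorem swap (h : InvertibleCompression T u₁ u₂ f₁ f₂) :
    InvertibleCompression T u₂ u₁ f₂ f₁ :=
  ⟨h.f₂u₂, h.f₂u₁, h.f₁u₂, h.f₁u₁, fun h0 => h.det_ne (by linear_combination h0)⟩

theorem shear (h : InvertibleCompression T u₁ u₂ f₁ f₂) (x : ℂ) :
    InvertibleCompression T (u₁ + x • u₂) u₂ f₁ (f₂ - x • f₁) where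
  f₁u₁ := by simp [h.f₁u₁, h.f₁u₂]
  f₁u₂ := h.f₁u₂
  f₂u₁ := by simp [h.f₁u₁, h.f₁u₂, h.f₂u₁, h.f₂u₂]
  f₂u₂ := by simp [h.f₁u₂, h.f₂u₂]
  det_ne := by
    convert h.det_ne using 1
    simp
    ring

theorem exists_diag_eq_of_ne_zero (h : InvertibleCompression T u₁ u₂ f₁ f₂)
    (hb : f₁ (T u₂) ≠ 0) :
    ∃ v₁ v₂ g₁ g₂, InvertibleCompression T v₁ v₂ g₁ g₂ ∧ g₁ (T v₁) = g₂ (T v₂) := by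
  refine ⟨_, _, _, _, h.shear ((f₂ (T u₂) - f₁ (T u₁)) / (2 * f₁ (T u₂))), ?_⟩
  simp
  field_simp
  ring

theorem exists_diag_eq (h : InvertibleCompression T u₁ u₂ f₁ f₂) :
    ∃ v₁ v₂ g₁ g₂, InvertibleCompression T v₁ v₂ g₁ g₂ ∧ g₁ (T v₁) = g₂ (T v₂) := by
  by_cases hb : f₁ (T u₂) = 0
  · by_cases hc : f₂ (T u₁) = 0
    · by_cases hd : f₁ (T u₁) = f₂ (T u₂)
      · exact ⟨_, _, _, _, h, hd⟩
      · refine (h.shear 1).swap.exists_diag_eq_of_ne_zero ?_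
        simpa [hb, hc, sub_eq_zero] using Ne.symm hd
    · exact h.swap.exists_diag_eq_of_ne_zero hc
  · exact h.exists_diag_eq_of_ne_zero hb

theorem pow_apply (h : InvertibleCompression T u₁ u₂ f₁ f₂) (ω : ℂ) (n : ℕ) (x : X) :
    ((f₁.smulRight u₁ + ω • f₂.smulRight u₂) ^ (n + 1)) x
      = f₁ x • u₁ + (ω ^ (n + 1) * f₂ x) • u₂ := by
  induction n with
  | zero => simp [smul_smul]
  | succ n ih =>
    rw [pow_succ', mul_apply_eq_comp, ih]
    simp [h.f₁u₁, h.f₁u₂, h.f₂u₁, h.f₂u₂, smul_smul]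
    congr 1
    ring

theorem mem_spectrum (h : InvertibleCompression T u₁ u₂ f₁ f₂)
    (hd : f₁ (T u₁) = f₂ (T u₂)) {R : X →L[ℂ] X}
    (hR : ∀ x, R x = f₁ (T x) • u₁ - f₂ (T x) • u₂) {l : ℂ}
    (hl : l ^ 2 = f₁ (T u₁) * f₂ (T u₂) - f₁ (T u₂) * f₂ (T u₁)) : l ∈ spectrum ℂ R := by
  have hl0 : l ≠ 0 := by
    rintro rfl
    exact h.det_ne (by simpa using hl.symm)
  by_cases hb : f₁ (T u₂) = 0 ∧ l = f₂ (T u₂)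
  · refine mem_spectrum_of_apply_eq_smul
      (v := (l + f₁ (T u₁)) • u₁ - f₂ (T u₁) • u₂) (fun h0 => hl0 ?_) ?_
    · have := congrArg f₁ h0
      simp [h.f₁u₁, h.f₁u₂, hd, ← hb.2] at this
      exact this
    · rw [hR]
      simp only [map_sub, map_smul, smul_eq_mul]
      match_scalars
      · linear_combination -hl + f₁ (T u₁) * hd
      · linear_combination -f₂ (T u₁) * hd
  · refine mem_spectrum_of_apply_eq_smul
      (v := f₁ (T u₂) • u₁ + (l - f₁ (T u₁)) • u₂) (fun h0 => hb ⟨?_, ?_⟩) ?_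
    · simpa [h.f₁u₁, h.f₁u₂] using congrArg f₁ h0
    · simpa [h.f₂u₁, h.f₂u₂, sub_eq_zero, hd] using congrArg f₂ h0
    · rw [hR]
      simp only [map_add, map_smul, smul_eq_mul]
      match_scalars
      · ring
      · linear_combination -hl + l * hd

theorem eq_of_mem_spectrum (h : InvertibleCompression T u₁ u₂ f₁ f₂)
    (hd : f₁ (T u₁) = f₂ (T u₂)) {R : X →L[ℂ] X}
    (hR : ∀ x, R x = f₁ (T x) • u₁ - f₂ (T x) • u₂) {l : ℂ}
    (hl : l ^ 2 = f₁ (T u₁) * f₂ (T u₂) - f₁ (T u₂) * f₂ (T u₁)) {z : ℂ}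
    (hz : z ∈ spectrum ℂ R) : z = 0 ∨ z = l ∨ z = -l := by
  have : Nontrivial X := by
    refine ⟨u₁, 0, ?_⟩
    rintro rfl
    simpa using h.f₁u₁
  have := eval_eq_zero_of_mem_spectrum
    (p := Polynomial.X ^ 3 - Polynomial.C (l ^ 2) * Polynomial.X) (by
      ext x
      simp [Algebra.algebraMap_eq_smul_one, pow_succ, hR]
      match_scalars
      · linear_combination -f₁ (T x) * hl + (f₁ (T x) * f₁ (T u₁) - f₂ (T x) * f₁ (T u₂)) * hd
      · linear_combination f₂ (T x) * hl + (f₂ (T x) * f₂ (T u₂) - f₁ (T x) * f₂ (T u₁)) * hd) hz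
  have h3 : z * ((z - l) * (z + l)) = 0 := by
    simp at this
    linear_combination this
  rcases mul_eq_zero.1 h3 with h0 | h0
  · exact Or.inl h0
  · rcases mul_eq_zero.1 h0 with h0 | h0
    · exact Or.inr (Or.inl (sub_eq_zero.1 h0))
    · exact Or.inr (Or.inr (eq_neg_of_add_eq_zero_left h0))

theorem exists_rank_le_two_periSpec_ne_singleton (h : InvertibleCompression T u₁ u₂ f₁ f₂)
    (hd : f₁ (T u₁) = f₂ (T u₂)) {r s : ℕ} (hrs : 1 ≤ r + s) :
    ∃ B : X →L[ℂ] X, LinearMap.rank (B : X →ₗ[ℂ] X) ≤ 2 ∧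
      ∀ z : ℂ, periSpec (B ^ r * T * B ^ s) ≠ {z} := by
  obtain ⟨n, hn⟩ : ∃ n, r + s = n + 1 := ⟨r + s - 1, by omega⟩
  obtain ⟨ω, hω⟩ := IsAlgClosed.exists_pow_nat_eq (-1 : ℂ) (n := n + 1) (by omega)
  obtain ⟨l, hl⟩ := IsAlgClosed.exists_pow_nat_eq
    (f₁ (T u₁) * f₂ (T u₂) - f₁ (T u₂) * f₂ (T u₁)) (n := 2) (by omega)
  set B : X →L[ℂ] X := f₁.smulRight u₁ + ω • f₂.smulRight u₂ with hB
  refine ⟨B, ?_, fun z hz => ?_⟩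
  · have hle : LinearMap.range (B : X →ₗ[ℂ] X) ≤ Submodule.span ℂ {u₁, u₂} := by
      rintro _ ⟨x, rfl⟩
      rw [Submodule.mem_span_pair]
      exact ⟨f₁ x, ω * f₂ x, by simp [hB, smul_smul]⟩
    refine (Submodule.rank_mono hle).trans ((rank_span_le _).trans ?_)
    exact (Cardinal.mk_insert_le).trans (by simp [one_add_one_eq_two])
  · have hl0 : l ≠ 0 := by
      rintro rfl
      exact h.det_ne (by simpa using hl.symm)
    have hR : ∀ x, (B ^ s * (B ^ r * T)) x = f₁ (T x) • u₁ - f₂ (T x) • u₂ := by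
      intro x
      rw [← mul_assoc, ← pow_add, add_comm, hn, mul_apply_eq_comp, hB,
        h.pow_apply, hω]
      simp [sub_eq_add_neg]
    have hspec := spectrum.nonzero_mul_comm (𝕜 := ℂ) (B ^ r * T) (B ^ s)
    have hmem : ∀ w : ℂ, w ^ 2 = l ^ 2 → w ∈ spectrum ℂ (B ^ r * T * B ^ s) := by
      intro w hw
      have hw0 : w ≠ 0 := by
        rintro rfl
        exact hl0 (by simpa using hw.symm)
      exact (hspec.symm ▸ (⟨h.mem_spectrum hd hR (hw.trans hl), hw0⟩ :
        w ∈ spectrum ℂ (B ^ s * (B ^ r * T)) \ {0}) :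
        w ∈ spectrum ℂ (B ^ r * T * B ^ s) \ {0}).1
    have hrad := spectralRadius_eq_of_forall_le (hmem l rfl) fun w hw => by
      by_cases hw0 : w = 0
      · simp [hw0]
      · have hw' : w ∈ spectrum ℂ (B ^ s * (B ^ r * T)) \ {0} := hspec ▸ ⟨hw, hw0⟩
        rcases h.eq_of_mem_spectrum hd hR hl hw'.1 with rfl | rfl | rfl <;> simp
    have h1 : l ∈ periSpec (B ^ r * T * B ^ s) := ⟨hmem l rfl, hrad.symm⟩
    have h2 : -l ∈ periSpec (B ^ r * T * B ^ s) :=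
      ⟨hmem (-l) (by ring), by rw [hrad, nnnorm_neg]⟩
    rw [hz, Set.mem_singleton_iff] at h1 h2
    exact hl0 (self_eq_neg.1 (h1.trans h2.symm))

end InvertibleCompression

/-- Lemma 3.3: for a nonzero bounded operator `A` on a complex Hilbert space `H` of dimension
at least two and nonnegative integers `r, s` with `r + s ≥ 1`, the following are equivalent:
(1) `A` has rank one;
(2) for every bounded operator `B`, `σ_π(B^r A* B^s)` is a singleton;
(3) for every bounded operator `B` of rank at most two, `σ_π(B^r A* B^s)` is a singleton. -/
theorem rankOne_iff_periSpec_adjoint_singleton {H : Type*} [NormedAddCommGroup H]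
    [InnerProductSpace ℂ H] [CompleteSpace H] (hdim : 2 ≤ Module.rank ℂ H)
    (r s : ℕ) (hrs : 1 ≤ r + s) (A : H →L[ℂ] H) (hA : A ≠ 0) :
    List.TFAE [
      LinearMap.rank (A : H →ₗ[ℂ] H) = 1,
      ∀ B : H →L[ℂ] H, ∃ z : ℂ,
        periSpec (B ^ r * ContinuousLinearMap.adjoint A * B ^ s) = {z},
      ∀ B : H →L[ℂ] H, LinearMap.rank (B : H →ₗ[ℂ] H) ≤ 2 →
        ∃ z : ℂ, periSpec (B ^ r * ContinuousLinearMap.adjoint A * B ^ s) = {z}] := by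
  have hA' : (A : H →ₗ[ℂ] H) ≠ 0 := by
    exact fun h => hA (ContinuousLinearMap.coe_injective h)
  have : Nontrivial H := by
    rw [← rank_pos_iff_nontrivial (R := ℂ)]
    exact lt_of_lt_of_le (by simp) hdim
  tfae_have 1 → 2 := by
    intro h B
    obtain ⟨v, hv⟩ := (rank_eq_one_iff_forall_exists_smul hA').1 h
    obtain ⟨f, w, hfw⟩ := exists_adjoint_eq_smulRight hv
    have hS : B ^ r * ContinuousLinearMap.adjoint A * B ^ s
        = (f.comp (B ^ s)).smulRight ((B ^ r) w) := by
      ext x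
      simp [hfw]
    exact ⟨_, hS ▸ periSpec_smulRight_eq_singleton _ _⟩
  tfae_have 2 → 3 := fun h B _ => h B
  tfae_have 3 → 1 := by
    intro h
    by_contra hrank
    have hind : ∃ x y, ∀ a b : ℂ, a • ContinuousLinearMap.adjoint A x
        + b • ContinuousLinearMap.adjoint A y = 0 → a = 0 ∧ b = 0 := by
      by_contra! hcon
      obtain ⟨x, hx⟩ : ∃ x, ContinuousLinearMap.adjoint A x ≠ 0 := by
        by_contra! h0
        refine hA ((map_eq_zero_iff ContinuousLinearMap.adjoint
          (LinearIsometryEquiv.injective _)).1 ?_)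
        ext x
        exact h0 x
      have hspan : ∀ y, ∃ c : ℂ,
          ContinuousLinearMap.adjoint A y = c • ContinuousLinearMap.adjoint A x := by
        intro y
        obtain ⟨a, b, hab, hne⟩ := hcon x y
        have hb : b ≠ 0 := by
          rintro rfl
          have ha : a = 0 := by simpa [hx] using hab
          exact hne ha rfl
        refine ⟨-(b⁻¹ * a), ?_⟩
        rw [neg_smul, mul_smul, ← smul_neg, eq_inv_smul_iff₀ hb]
        exact eq_neg_of_add_eq_zero_right hab
      obtain ⟨f, w, hfw⟩ := exists_adjoint_eq_smulRight hspan
      rw [ContinuousLinearMap.adjoint_adjoint] at hfw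
      exact hrank ((rank_eq_one_iff_forall_exists_smul hA').2
        ⟨w, fun y => ⟨f y, by simp [hfw]⟩⟩)
    obtain ⟨x, y, hxy⟩ := hind
    obtain ⟨u₁, u₂, f₁, f₂, hc⟩ := exists_invertibleCompression hxy
    obtain ⟨v₁, v₂, g₁, g₂, hc', hd⟩ := hc.exists_diag_eq
    obtain ⟨B, hB, hne⟩ := hc'.exists_rank_le_two_periSpec_ne_singleton hd hrs
    obtain ⟨z, hz⟩ := h B hB
    exact hne z hz
  tfae_finish
end

section
/- Let A₁ and A₂ be standard operator algebras on complex Hilbert spaces H and K respectively with I ∈ A₁, let r, s be nonnegative integers with r + s ≥ 1, and let Φ : A₁ → A₂ be a map whose range contains all operators of rank at most two, which satisfies σ_π(B^r A* B^s) = σ_π(Φ(B)^r Φ(A)* Φ(B)^s) for all A, B ∈ A₁, and which satisfies Φ(I) = I. Then Φ preserves rank-one projections in both directions (P ∈ A₁ is a rank-one projection if and only if Φ(P) is a rank-one projection, and every rank-one projection on K is of the form Φ(P) for a rank-one projection P), and there exists a unitary or conjugate-unitary (antiunitary) operator U : H → K such that Φ(x⊗x) = (Ux)⊗(Ux) for every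 unit vector x ∈ H. -/
open scoped ENNReal

/-- For `x` in a complex Hilbert space `E`, the operator `x ⊗ x : z ↦ ⟨z, x⟩ x`;
for a unit vector `x` this is the rank-one projection onto `ℂx`. -/
noncomputable def vecProj {E : Type*} [NormedAddCommGroup E] [InnerProductSpace ℂ E]
    (x : E) : E →L[ℂ] E :=
  (ContinuousLinearMap.toSpanSingleton ℂ x).comp (innerSL ℂ x)

/-- A rank-one projection on a complex Hilbert space: a self-adjoint idempotent of
rank one. -/
def IsRankOneProjection {E : Type*} [NormedAddCommGroup E] [InnerProductSpace ℂ E]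
    [CompleteSpace E] (T : E →L[ℂ] E) : Prop :=
  IsIdempotentElem T ∧ IsSelfAdjoint T ∧ LinearMap.rank (T : E →ₗ[ℂ] E) = 1

open InnerProductSpace ContinuousLinearMap

section PeripheralSpectrum

variable {E : Type*} [NormedAddCommGroup E] [InnerProductSpace ℂ E]

theorem vecProj_eq_rankOne (x : E) : vecProj x = rankOne ℂ x x := rfl

theorem mul_rankOne (S : E →L[ℂ] E) (x y : E) : S * rankOne ℂ x y = rankOne ℂ (S x) y := by
  ext z; simp

theorem rankOne_mul_rankOne (a b c d : E) :
    rankOne ℂ a b * rankOne ℂ c d = inner ℂ b c • rankOne ℂ a d := by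
  ext z; simp [smul_smul, mul_comm]

theorem rankOne_pow_succ (x y : E) (m : ℕ) :
    rankOne ℂ x y ^ (m + 1) = inner ℂ y x ^ m • rankOne ℂ x y := by
  induction m with
  | zero => simp
  | succ m ih =>
    rw [pow_succ, ih, smul_mul_assoc, rankOne_mul_rankOne, smul_smul, pow_succ]

theorem rank_rankOne_le_one (x y : E) :
    LinearMap.rank (rankOne ℂ x y : E →ₗ[ℂ] E) ≤ 1 := by
  by_cases hx : x = 0
  · subst hx
    simp [LinearMap.rank_zero]
  by_cases hy : y = 0
  · subst hy
    simp [LinearMap.rank_zero]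
  exact (rank_rankOne hx hy).le

theorem vecProj_smul (c : ℂ) (hc : ‖c‖ = 1) (x : E) : vecProj (c • x) = vecProj x := by
  have h : (starRingEnd ℂ) c * c = 1 := by
    rw [mul_comm, Complex.mul_conj, Complex.normSq_eq_norm_sq, hc]; norm_num
  simp only [vecProj_eq_rankOne]
  ext z
  simp [smul_smul, mul_comm c, h]

theorem spectrum_subset_of_mul_self_eq_smul {T : E →L[ℂ] E} {c : ℂ} (h : T * T = c • T) :
    spectrum ℂ T ⊆ {0, c} := by
  intro z hz
  by_contra hne
  simp only [Set.mem_insert_iff, Set.mem_singleton_iff, not_or] at hne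
  obtain ⟨h0, hc⟩ := hne
  have hzc : z - c ≠ 0 := sub_ne_zero.mpr hc
  apply hz
  rw [spectrum.mem_resolventSet_iff, Algebra.algebraMap_eq_smul_one]
  refine ⟨⟨z • 1 - T, z⁻¹ • 1 + (z⁻¹ * (z - c)⁻¹) • T, ?_, ?_⟩, rfl⟩
  all_goals
    simp only [sub_mul, mul_sub, add_mul, mul_add, smul_mul_assoc, mul_smul_comm, one_mul, mul_one,
      smul_smul, h, smul_sub, smul_add]
    match_scalars <;> field_simp
    ring

theorem spectralRadius_eq_iSup_diff_zero (T : E →L[ℂ] E) :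
    spectralRadius ℂ T = ⨆ k ∈ spectrum ℂ T \ {0}, (‖k‖₊ : ℝ≥0∞) := by
  apply le_antisymm
  · refine iSup₂_le fun z hz => ?_
    by_cases h : z = 0
    · simp [h]
    · exact le_iSup₂ (f := fun (k : ℂ) (_ : k ∈ spectrum ℂ T \ {0}) => (‖k‖₊ : ℝ≥0∞)) z ⟨hz, h⟩
  · exact iSup₂_le fun z hz =>
      le_iSup₂ (f := fun (k : ℂ) (_ : k ∈ spectrum ℂ T) => (‖k‖₊ : ℝ≥0∞)) z hz.1

theorem spectralRadius_mul_comm (S T : E →L[ℂ] E) :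
    spectralRadius ℂ (S * T) = spectralRadius ℂ (T * S) := by
  rw [spectralRadius_eq_iSup_diff_zero, spectralRadius_eq_iSup_diff_zero,
    spectrum.nonzero_mul_comm]

theorem biorthogonal_pow_succ {u₁ u₂ φ₁ φ₂ : E} (h₁₁ : inner ℂ φ₁ u₁ = 1)
    (h₁₂ : inner ℂ φ₁ u₂ = 0) (h₂₁ : inner ℂ φ₂ u₁ = 0) (h₂₂ : inner ℂ φ₂ u₂ = 1)
    (a b : ℂ) (m : ℕ) :
    (a • rankOne ℂ u₁ φ₁ + b • rankOne ℂ u₂ φ₂) ^ (m + 1) =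
      a ^ (m + 1) • rankOne ℂ u₁ φ₁ + b ^ (m + 1) • rankOne ℂ u₂ φ₂ := by
  induction m with
  | zero => simp
  | succ m ih =>
    rw [pow_succ, ih]
    simp only [add_mul, mul_add, smul_mul_assoc, mul_smul_comm, rankOne_mul_rankOne, h₁₁, h₁₂, h₂₁,
      h₂₂]
    module

variable [CompleteSpace E]

theorem periSpec_rankOne [Nontrivial E] (x y : E) :
    periSpec (rankOne ℂ x y) = {inner ℂ y x} := by
  have hsub := spectrum_subset_of_mul_self_eq_smul (rankOne_mul_rankOne x y x y)
  have hmem : inner ℂ y x ∈ spectrum ℂ (rankOne ℂ x y) := by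
    by_cases hc : inner ℂ y x = 0
    · rw [hc] at hsub ⊢
      obtain ⟨z, hz⟩ := spectrum.nonempty (rankOne ℂ x y)
      have := hsub hz
      simp only [Set.mem_insert_iff, Set.mem_singleton_iff, or_self] at this
      exact this ▸ hz
    · have hx : x ≠ 0 := by rintro rfl; simp at hc
      intro hu
      have := (ContinuousLinearMap.isUnit_iff_bijective.mp hu).1
      apply hx
      apply this
      simp [Algebra.algebraMap_eq_smul_one]
  have hrad : spectralRadius ℂ (rankOne ℂ x y) = ‖(inner ℂ y x : ℂ)‖₊ := by
    apply le_antisymm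
    · refine iSup₂_le fun z hz => ?_
      rcases hsub hz with h | h <;> simp_all
    · exact le_iSup₂ (f := fun (k : ℂ) (_ : k ∈ spectrum ℂ (rankOne ℂ x y)) => (‖k‖₊ : ℝ≥0∞)) _ hmem
  ext z
  simp only [periSpec, hrad, Set.mem_ofPred_eq, Set.mem_singleton_iff]
  constructor
  · rintro ⟨hz, hn⟩
    rcases hsub hz with h | h
    · subst h
      simp only [nnnorm_zero, ENNReal.coe_zero] at hn
      have := hn.symm
      simp only [ENNReal.coe_eq_zero, nnnorm_eq_zero] at this
      exact this.symm
    · exact h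
  · rintro rfl
    exact ⟨hmem, rfl⟩

theorem periSpec_mul_subset [Nontrivial E] (S T : E →L[ℂ] E) :
    periSpec (S * T) ⊆ periSpec (T * S) := by
  rintro z ⟨hz, hn⟩
  refine ⟨?_, hn.trans (spectralRadius_mul_comm S T)⟩
  by_cases h : z = 0
  · subst h
    have hr : spectralRadius ℂ (T * S) = 0 := by
      rw [← spectralRadius_mul_comm, ← hn]; simp
    obtain ⟨w, hw⟩ := spectrum.nonempty (T * S)
    have : (‖w‖₊ : ℝ≥0∞) ≤ 0 := hr ▸
      le_iSup₂ (f := fun (k : ℂ) (_ : k ∈ spectrum ℂ (T * S)) => (‖k‖₊ : ℝ≥0∞)) w hw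
    have hw0 : w = 0 := by simpa using this
    exact hw0 ▸ hw
  · have : z ∈ spectrum ℂ (S * T) \ {0} := ⟨hz, h⟩
    rw [spectrum.nonzero_mul_comm] at this
    exact this.1

theorem periSpec_mul_comm [Nontrivial E] (S T : E →L[ℂ] E) :
    periSpec (S * T) = periSpec (T * S) :=
  (periSpec_mul_subset S T).antisymm (periSpec_mul_subset T S)

/-- The peripheral spectrum of `B ^ r * A * B ^ s` only depends on `r + s`. -/
theorem periSpec_pow_mul_mul_pow [Nontrivial E] (A B : E →L[ℂ] E) (r s : ℕ) :
    periSpec (B ^ r * A * B ^ s) = periSpec (A * B ^ (r + s)) := by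
  rw [mul_assoc, periSpec_mul_comm, mul_assoc, ← pow_add, add_comm]

theorem periSpec_mul_rankOne_pow_succ [Nontrivial E] (S : E →L[ℂ] E) (x y : E)
    (m : ℕ) : periSpec (S * rankOne ℂ x y ^ (m + 1)) = {inner ℂ y x ^ m * inner ℂ y (S x)} := by
  rw [rankOne_pow_succ, mul_smul_comm, mul_rankOne, ← smul_apply,
    ← map_smul, periSpec_rankOne, inner_smul_right]

/-- With `u₁, u₂` biorthogonal to `φ₁, φ₂`, the nonzero spectrum of
`S * (α • u₁ ⊗ φ₁ + β • u₂ ⊗ φ₂)` is that of a `2 × 2` matrix; if this matrix is invertible of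
trace zero, then each square root of minus its determinant is a spectral value. -/
theorem mem_spectrum_mul_of_trace_eq_zero {S : E →L[ℂ] E} {u₁ u₂ φ₁ φ₂ : E} {α β μ : ℂ}
    (htr : α * inner ℂ φ₁ (S u₁) + β * inner ℂ φ₂ (S u₂) = 0)
    (hdet : inner ℂ φ₁ (S u₁) * inner ℂ φ₂ (S u₂) -
      inner ℂ φ₁ (S u₂) * inner ℂ φ₂ (S u₁) ≠ 0)
    (hμ : μ ^ 2 = -(α * β * (inner ℂ φ₁ (S u₁) * inner ℂ φ₂ (S u₂) -
      inner ℂ φ₁ (S u₂) * inner ℂ φ₂ (S u₁)))) (hμ0 : μ ≠ 0) :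
    μ ∈ spectrum ℂ (S * (α • rankOne ℂ u₁ φ₁ + β • rankOne ℂ u₂ φ₂)) := by
  intro hu
  have hinj := (ContinuousLinearMap.isUnit_iff_bijective.mp hu).1
  set N := S * (α • rankOne ℂ u₁ φ₁ + β • rankOne ℂ u₂ φ₂) with hN
  have hNz (z : E) : N z = (α * inner ℂ φ₁ z) • S u₁ + (β * inner ℂ φ₂ z) • S u₂ := by
    simp [hN, smul_smul]
  set s₁₁ : ℂ := inner ℂ φ₁ (S u₁)
  set s₁₂ : ℂ := inner ℂ φ₁ (S u₂)
  set s₂₁ : ℂ := inner ℂ φ₂ (S u₁)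
  set s₂₂ : ℂ := inner ℂ φ₂ (S u₂)
  have key (z : E) (hz : N (N z) = μ ^ 2 • z) : N z + μ • z = 0 := by
    apply hinj
    simp only [Algebra.algebraMap_eq_smul_one, sub_apply,
      smul_apply, one_apply_eq_self, map_add, map_smul, hz, map_zero]
    module
  have hp : N (S u₁) = (α * s₁₁) • S u₁ + (β * s₂₁) • S u₂ := hNz _
  have hq : N (S u₂) = (α * s₁₂) • S u₁ + (β * s₂₂) • S u₂ := hNz _
  have hNp := key (S u₁) (by
    rw [hp, map_add, map_smul, map_smul, hp, hq, hμ]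
    match_scalars <;> [linear_combination (α * s₁₁) * htr; linear_combination (β * s₂₁) * htr])
  have hNq := key (S u₂) (by
    rw [hq, map_add, map_smul, map_smul, hp, hq, hμ]
    match_scalars <;> [linear_combination (α * s₁₂) * htr; linear_combination (β * s₂₂) * htr])
  rw [hp] at hNp
  rw [hq] at hNq
  have p1 := congrArg (inner ℂ φ₁) hNp
  have p2 := congrArg (inner ℂ φ₂) hNp
  have q1 := congrArg (inner ℂ φ₁) hNq
  have q2 := congrArg (inner ℂ φ₂) hNq
  simp only [inner_add_right, inner_smul_right, inner_zero_right] at p1 p2 q1 q2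
  have h1 : α * s₁₁ + μ = 0 := by
    apply (mul_eq_zero.mp (_ : (α * s₁₁ + μ) * (s₁₁ * s₂₂ - s₁₂ * s₂₁) = 0)).resolve_right hdet
    linear_combination s₂₂ * p1 - s₁₂ * p2
  have h2 : β * s₂₂ + μ = 0 := by
    apply (mul_eq_zero.mp (_ : (β * s₂₂ + μ) * (s₁₁ * s₂₂ - s₁₂ * s₂₁) = 0)).resolve_right hdet
    linear_combination s₁₁ * q2 - s₂₁ * q1
  apply hμ0
  linear_combination (h1 + h2 - htr) / 2

theorem not_subsingleton_periSpec_mul {S : E →L[ℂ] E} {u₁ u₂ φ₁ φ₂ : E} {α β : ℂ}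
    (htr : α * inner ℂ φ₁ (S u₁) + β * inner ℂ φ₂ (S u₂) = 0)
    (hα : α ≠ 0) (hβ : β ≠ 0)
    (hdet : inner ℂ φ₁ (S u₁) * inner ℂ φ₂ (S u₂) -
      inner ℂ φ₁ (S u₂) * inner ℂ φ₂ (S u₁) ≠ 0) :
    ¬ (periSpec (S * (α • rankOne ℂ u₁ φ₁ + β • rankOne ℂ u₂ φ₂))).Subsingleton := by
  obtain ⟨μ, hμ⟩ := IsAlgClosed.exists_pow_nat_eq (-(α * β * (inner ℂ φ₁ (S u₁) *
    inner ℂ φ₂ (S u₂) - inner ℂ φ₁ (S u₂) * inner ℂ φ₂ (S u₁)))) zero_lt_two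
  have hμ0 : μ ≠ 0 := by
    rintro rfl
    apply mul_ne_zero (mul_ne_zero hα hβ) hdet
    linear_combination hμ
  have hpos := mem_spectrum_mul_of_trace_eq_zero htr hdet hμ hμ0
  have hneg := mem_spectrum_mul_of_trace_eq_zero htr hdet (μ := -μ) (by rw [neg_sq, hμ])
    (neg_ne_zero.mpr hμ0)
  set N := S * (α • rankOne ℂ u₁ φ₁ + β • rankOne ℂ u₂ φ₂) with hN
  have hNz (z : E) : N z = (α * inner ℂ φ₁ z) • S u₁ + (β * inner ℂ φ₂ z) • S u₂ := by
    simp [hN, smul_smul]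
  set s₁₁ : ℂ := inner ℂ φ₁ (S u₁)
  set s₁₂ : ℂ := inner ℂ φ₁ (S u₂)
  set s₂₁ : ℂ := inner ℂ φ₂ (S u₁)
  set s₂₂ : ℂ := inner ℂ φ₂ (S u₂)
  have hcube : (N * N) * (N * N) = μ ^ 2 • (N * N) := by
    have hp : N (S u₁) = (α * s₁₁) • S u₁ + (β * s₂₁) • S u₂ := hNz _
    have hq : N (S u₂) = (α * s₁₂) • S u₁ + (β * s₂₂) • S u₂ := hNz _
    have hp2 : N (N (S u₁)) = μ ^ 2 • S u₁ := by
      rw [hp, map_add, map_smul, map_smul, hp, hq, hμ]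
      match_scalars <;> [linear_combination (α * s₁₁) * htr; linear_combination (β * s₂₁) * htr]
    have hq2 : N (N (S u₂)) = μ ^ 2 • S u₂ := by
      rw [hq, map_add, map_smul, map_smul, hp, hq, hμ]
      match_scalars <;> [linear_combination (α * s₁₂) * htr; linear_combination (β * s₂₂) * htr]
    ext z
    simp only [mul_apply_eq_comp, smul_apply]
    rw [hNz z]
    simp only [map_add, map_smul, hp2, hq2]
    simp only [smul_add, smul_comm (μ ^ 2)]
  have hrad : spectralRadius ℂ N = ‖μ‖₊ := by
    apply le_antisymm
    · refine iSup₂_le fun z hz => ?_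
      have hz2 : z ^ 2 ∈ spectrum ℂ (N * N) := by
        rw [← pow_two]
        exact spectrum.pow_image_subset N 2 ⟨z, hz, rfl⟩
      rcases spectrum_subset_of_mul_self_eq_smul hcube hz2 with h | h
      · simp [pow_eq_zero_iff] at h
        simp [h]
      · rcases sq_eq_sq_iff_eq_or_eq_neg.mp h with h | h <;> simp [h]
    · exact le_iSup₂ (f := fun (k : ℂ) (_ : k ∈ spectrum ℂ N) => (‖k‖₊ : ℝ≥0∞)) μ hpos
  intro hs
  have : μ = -μ := hs ⟨hpos, hrad.symm⟩ ⟨hneg, by rw [nnnorm_neg, hrad]⟩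
  exact hμ0 (self_eq_neg.mp this)

/-- An operator all of whose products with `(m + 1)`-st powers of operators of rank at most two
have at most one peripheral spectral value has vanishing biorthogonal `2 × 2` minors, as soon as
the diagonal can be balanced. -/
theorem minor_eq_zero_of_biorthogonal {S : E →L[ℂ] E} {m : ℕ}
    (hS : ∀ T : E →L[ℂ] E, LinearMap.rank (T : E →ₗ[ℂ] E) ≤ 2 →
      (periSpec (S * T ^ (m + 1))).Subsingleton)
    {u₁ u₂ φ₁ φ₂ : E} (h₁₁ : inner ℂ φ₁ u₁ = 1)
    (h₁₂ : inner ℂ φ₁ u₂ = 0) (h₂₁ : inner ℂ φ₂ u₁ = 0) (h₂₂ : inner ℂ φ₂ u₂ = 1)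
    {α β : ℂ} (hα : α ≠ 0) (hβ : β ≠ 0)
    (htr : α * inner ℂ φ₁ (S u₁) + β * inner ℂ φ₂ (S u₂) = 0) :
    inner ℂ φ₁ (S u₁) * inner ℂ φ₂ (S u₂) - inner ℂ φ₁ (S u₂) * inner ℂ φ₂ (S u₁) = 0 := by
  by_contra hdet
  obtain ⟨a, ha⟩ := IsAlgClosed.exists_pow_nat_eq α m.succ_pos
  obtain ⟨b, hb⟩ := IsAlgClosed.exists_pow_nat_eq β m.succ_pos
  apply not_subsingleton_periSpec_mul htr hα hβ hdet
  rw [← ha, ← hb, ← biorthogonal_pow_succ h₁₁ h₁₂ h₂₁ h₂₂]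
  apply hS
  rw [← smul_apply, ← map_smul, ← smul_apply, ← map_smul,
    ContinuousLinearMap.toLinearMap_add]
  refine (LinearMap.rank_add_le _ _).trans ?_
  rw [← one_add_one_eq_two]
  exact add_le_add (rank_rankOne_le_one _ _) (rank_rankOne_le_one _ _)

theorem minor_eq_zero {S : E →L[ℂ] E} {m : ℕ}
    (hS : ∀ T : E →L[ℂ] E, LinearMap.rank (T : E →ₗ[ℂ] E) ≤ 2 →
      (periSpec (S * T ^ (m + 1))).Subsingleton)
    {u w : E} (hu : ‖u‖ = 1) (hw : ‖w‖ = 1) (huw : inner ℂ u w = 0) :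
    inner ℂ u (S u) * inner ℂ w (S w) - inner ℂ u (S w) * inner ℂ w (S u) = 0 := by
  have hwu : inner ℂ w u = 0 := inner_eq_zero_symm.mp huw
  have huu : inner ℂ u u = 1 := by simp [inner_self_eq_norm_sq_to_K, hu]
  have hww : inner ℂ w w = 1 := by simp [inner_self_eq_norm_sq_to_K, hw]
  by_cases h : inner ℂ w (S u) = 0
  · by_contra hdet
    have h1 : inner ℂ u (S u) ≠ 0 := by intro h'; simp [h, h'] at hdet
    have h2 : inner ℂ w (S w) ≠ 0 := by intro h'; simp [h, h'] at hdet
    exact hdet (minor_eq_zero_of_biorthogonal hS huu huw hwu hww h2 (neg_ne_zero.mpr h1) (by ring))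
  · set c : ℂ := (inner ℂ u (S u) - inner ℂ w (S w)) / (2 * inner ℂ w (S u)) with hc
    have hc' : 2 * (c * inner ℂ w (S u)) = inner ℂ u (S u) - inner ℂ w (S w) := by
      rw [hc]; field_simp
    have := minor_eq_zero_of_biorthogonal hS (u₁ := u) (u₂ := w + c • u)
      (φ₁ := u - (starRingEnd ℂ c) • w) (φ₂ := w) (α := 1) (β := -1)
      (by simp only [inner_sub_left, inner_smul_left, huu, hwu]; ring)
      (by simp only [inner_sub_left, inner_smul_left, inner_add_right, inner_smul_right, huu, hwu,
        huw, hww, Complex.conj_conj]; ring) hwu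
      (by simp only [inner_add_right, inner_smul_right, hwu, hww]; ring)
      one_ne_zero (by simp) (by
        simp only [inner_sub_left, inner_smul_left, inner_add_right, inner_smul_right, map_add,
          map_smul, Complex.conj_conj]
        linear_combination -hc')
    simp only [inner_sub_left, inner_smul_left, inner_add_right, inner_smul_right, map_add,
      map_smul, Complex.conj_conj] at this
    linear_combination this

theorem exists_eq_rankOne {S : E →L[ℂ] E} {m : ℕ}
    (hS : ∀ T : E →L[ℂ] E, LinearMap.rank (T : E →ₗ[ℂ] E) ≤ 2 →
      (periSpec (S * T ^ (m + 1))).Subsingleton) :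
    ∃ a b : E, S = rankOne ℂ a b := by
  by_cases h0 : S = 0
  · exact ⟨0, 0, by simp [h0]⟩
  have : ∃ u : E, ‖u‖ = 1 ∧ inner ℂ u (S u) ≠ 0 := by
    by_contra! hcon
    apply h0
    ext z
    have : ∀ z, inner ℂ (S z) z = 0 := by
      intro z
      by_cases hz : z = 0
      · simp [hz]
      have hz' : (‖z‖ : ℂ) ≠ 0 := by simpa using hz
      have := hcon (((‖z‖ : ℂ)⁻¹) • z) (by simp [norm_smul, hz])
      simp only [map_smul, inner_smul_left, inner_smul_right, mul_eq_zero, map_inv₀,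
        Complex.conj_ofReal, inv_eq_zero, hz', false_or] at this
      exact inner_eq_zero_symm.mp this
    exact DFunLike.congr_fun ((inner_map_self_eq_zero (S : E →ₗ[ℂ] E)).mp this) z
  obtain ⟨u, hu, hc⟩ := this
  have huu : inner ℂ u u = 1 := by simp [inner_self_eq_norm_sq_to_K, hu]
  have horth (w : E) (huw : inner ℂ u w = 0) :
      inner ℂ u (S u) * inner ℂ w (S w) - inner ℂ u (S w) * inner ℂ w (S u) = 0 := by
    by_cases hw : w = 0
    · simp [hw]
    have hw' : (‖w‖ : ℂ) ≠ 0 := by simpa using hw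
    have := minor_eq_zero hS hu (w := ((‖w‖ : ℂ)⁻¹) • w) (by simp [norm_smul, hw])
      (by simp [huw])
    simp only [map_smul, inner_smul_left, inner_smul_right, map_inv₀, Complex.conj_ofReal] at this
    field_simp at this
    linear_combination this
  have hall (v : E) :
      inner ℂ u (S u) * inner ℂ v (S v) - inner ℂ u (S v) * inner ℂ v (S u) = 0 := by
    have := horth (v - inner ℂ u v • u) (by simp only [inner_sub_right, inner_smul_right, huu]; ring)
    simp only [inner_sub_left, inner_smul_left, inner_sub_right, inner_smul_right, map_sub,
      map_smul] at this
    linear_combination this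
  refine ⟨(inner ℂ u (S u))⁻¹ • S u, adjoint S u, ?_⟩
  ext z
  have := (ext_inner_map (S : E →ₗ[ℂ] E)
    (rankOne ℂ ((inner ℂ u (S u))⁻¹ • S u) (adjoint S u) : E →L[ℂ] E)).mp (by
    intro v
    have h := hall v
    rw [← inner_conj_symm, ← inner_conj_symm _ v]
    congr 1
    simp only [ContinuousLinearMap.coe_coe, rankOne_apply, adjoint_inner_left, inner_smul_right]
    field_simp
    linear_combination h)
  exact DFunLike.congr_fun this z

theorem exists_eq_vecProj_of_periSpec [Nontrivial E] {y g : E} {m : ℕ}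
    (h₁ : periSpec (adjoint (rankOne ℂ y g)) = {1})
    (h₂ : periSpec (adjoint (rankOne ℂ y g) * rankOne ℂ y g ^ (m + 1)) = {1}) :
    ∃ x : E, ‖x‖ = 1 ∧ rankOne ℂ y g = vecProj x := by
  rw [periSpec_mul_rankOne_pow_succ] at h₂
  rw [adjoint_rankOne] at h₁ h₂
  rw [periSpec_rankOne, Set.singleton_eq_singleton_iff] at h₁
  have hgy : inner ℂ g y = 1 := by rw [← inner_conj_symm, h₁, map_one]
  rw [Set.singleton_eq_singleton_iff, hgy, one_pow, one_mul, rankOne_apply, inner_smul_right,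
    inner_self_eq_norm_sq_to_K, inner_self_eq_norm_sq_to_K] at h₂
  have h₃ : (‖y‖ * ‖g‖) ^ 2 = 1 := by
    rw [mul_pow]
    apply Complex.ofReal_injective
    push_cast
    exact h₂
  have h₄ : ‖y‖ * ‖g‖ = 1 :=
    (pow_eq_one_iff_of_nonneg (by positivity) two_ne_zero).mp h₃
  have h₅ : inner ℂ y g = (‖y‖ : ℂ) * ‖g‖ := by rw [h₁]; exact_mod_cast h₄.symm
  have h₆ := inner_eq_norm_mul_iff.mp h₅
  have hy0 : y ≠ 0 := by rintro rfl; simp at h₄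
  have hy : (‖y‖ : ℂ) ≠ 0 := by simpa using hy0
  have hg : g = ((‖y‖ : ℂ)⁻¹ * ‖g‖) • y := by
    rw [mul_smul, eq_inv_smul_iff₀ hy]; exact h₆.symm
  have h₇ : (‖g‖ : ℂ) = (‖y‖ : ℂ)⁻¹ := by
    refine eq_inv_of_mul_eq_one_right ?_
    exact_mod_cast h₄
  refine ⟨(‖y‖ : ℂ)⁻¹ • y, by simp [norm_smul, hy0], ?_⟩
  rw [hg, h₇, vecProj_eq_rankOne]
  ext z
  simp [smul_smul, mul_comm]

theorem adjoint_vecProj (x : E) : adjoint (vecProj x) = vecProj x := by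
  rw [vecProj_eq_rankOne, adjoint_rankOne]

theorem isRankOneProjection_iff (T : E →L[ℂ] E) :
    IsRankOneProjection T ↔ ∃ x : E, ‖x‖ = 1 ∧ T = vecProj x := by
  constructor
  · rintro ⟨hid, hsa, hrank⟩
    obtain ⟨⟨v, hv⟩, hv0, hspan⟩ := rank_eq_one_iff.mp hrank
    obtain ⟨v', hv'⟩ := hv
    have hv0' : v ≠ 0 := fun h => hv0 (Subtype.ext h)
    have hvn : (‖v‖ : ℂ) ≠ 0 := by simpa using hv0'
    have hTv : T v = v := by
      rw [← hv']
      exact DFunLike.congr_fun hid v'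
    refine ⟨(‖v‖ : ℂ)⁻¹ • v, by simp [norm_smul, hv0'], ?_⟩
    ext z
    obtain ⟨c, hc⟩ := hspan ⟨T z, z, rfl⟩
    have hc : c • v = T z := congrArg Subtype.val hc
    have hin : inner ℂ v (T z) = inner ℂ v z := by
      rw [← adjoint_inner_left, ← star_eq_adjoint, hsa.star_eq, hTv]
    rw [← hc, inner_smul_right, inner_self_eq_norm_sq_to_K] at hin
    rw [vecProj_eq_rankOne, ← hc, rankOne_apply, inner_smul_left, ← hin, smul_smul]
    congr 1
    simp
    field_simp
  · rintro ⟨x, hx, rfl⟩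
    have hx0 : x ≠ 0 := by rintro rfl; simp at hx
    exact ⟨isIdempotentElem_rankOne_self hx, adjoint_vecProj x, rank_rankOne hx0 hx0⟩

end PeripheralSpectrum

section Preserver

variable {H K : Type*} [NormedAddCommGroup H] [InnerProductSpace ℂ H] [CompleteSpace H]
  [NormedAddCommGroup K] [InnerProductSpace ℂ K] [CompleteSpace K]

/-- A unital map `Ψ` from a standard operator algebra into the bounded operators such that
`A* B ^ (m + 1)` and `Ψ(A)* Ψ(B) ^ (m + 1)` always have the same peripheral spectrum, and whose
range contains the operators of rank at most two. -/
structure IsPeriSpecPreserver (A₁ : NonUnitalSubalgebra ℂ (H →L[ℂ] H)) (m : ℕ)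
    (Ψ : A₁ → K →L[ℂ] K) : Prop where
  mem_of_rank_lt : ∀ T : H →L[ℂ] H, LinearMap.rank (T : H →ₗ[ℂ] H) < Cardinal.aleph0 → T ∈ A₁
  one_mem : (1 : H →L[ℂ] H) ∈ A₁
  exists_map_eq : ∀ T : K →L[ℂ] K, LinearMap.rank (T : K →ₗ[ℂ] K) ≤ 2 → ∃ A : A₁, Ψ A = T
  periSpec_eq : ∀ A B : A₁, periSpec (adjoint (A : H →L[ℂ] H) * (B : H →L[ℂ] H) ^ (m + 1)) =
    periSpec (adjoint (Ψ A) * Ψ B ^ (m + 1))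
  map_one : Ψ ⟨1, one_mem⟩ = 1

namespace IsPeriSpecPreserver

variable {A₁ : NonUnitalSubalgebra ℂ (H →L[ℂ] H)} {m : ℕ} {Ψ : A₁ → K →L[ℂ] K}

theorem rankOne_mem (h : IsPeriSpecPreserver A₁ m Ψ) (x y : H) : rankOne ℂ x y ∈ A₁ :=
  h.mem_of_rank_lt _ ((rank_rankOne_le_one x y).trans_lt Cardinal.one_lt_aleph0)

theorem periSpec_adjoint (h : IsPeriSpecPreserver A₁ m Ψ) (A : A₁) :
    periSpec (adjoint (A : H →L[ℂ] H)) = periSpec (adjoint (Ψ A)) := by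
  simpa [h.map_one] using h.periSpec_eq A ⟨1, h.one_mem⟩

theorem exists_map_eq_rankOne [Nontrivial H] (h : IsPeriSpecPreserver A₁ m Ψ) (A : A₁) {a b : H}
    (hA : (A : H →L[ℂ] H) = rankOne ℂ a b) : ∃ c d : K, Ψ A = rankOne ℂ c d := by
  obtain ⟨c, d, hcd⟩ := exists_eq_rankOne (S := adjoint (Ψ A)) (m := m) (by
    intro T hT
    obtain ⟨B, rfl⟩ := h.exists_map_eq T hT
    rw [← h.periSpec_eq, hA, periSpec_mul_comm, adjoint_rankOne, mul_rankOne, periSpec_rankOne]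
    exact Set.subsingleton_singleton)
  refine ⟨d, c, ?_⟩
  rw [← adjoint_adjoint (Ψ A), hcd, adjoint_rankOne]

theorem exists_eq_rankOne_of_map [Nontrivial K] (h : IsPeriSpecPreserver A₁ m Ψ) (A : A₁) {c d : K}
    (hA : Ψ A = rankOne ℂ c d) : ∃ a b : H, (A : H →L[ℂ] H) = rankOne ℂ a b := by
  obtain ⟨a, b, hab⟩ := exists_eq_rankOne (S := adjoint (A : H →L[ℂ] H)) (m := m) (by
    intro T hT
    have := h.periSpec_eq A ⟨T, h.mem_of_rank_lt T (hT.trans_lt Cardinal.ofNat_lt_aleph0)⟩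
    rw [this, hA, periSpec_mul_comm, adjoint_rankOne, mul_rankOne, periSpec_rankOne]
    exact Set.subsingleton_singleton)
  refine ⟨b, a, ?_⟩
  rw [← adjoint_adjoint (A : H →L[ℂ] H), hab, adjoint_rankOne]

variable [Nontrivial H] [Nontrivial K]

theorem exists_map_eq_vecProj (h : IsPeriSpecPreserver A₁ m Ψ) (A : A₁) {x : H} (hx : ‖x‖ = 1)
    (hA : (A : H →L[ℂ] H) = vecProj x) : ∃ y : K, ‖y‖ = 1 ∧ Ψ A = vecProj y := by
  obtain ⟨c, d, hcd⟩ := h.exists_map_eq_rankOne A hA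
  have hxx : inner ℂ x x = 1 := by rw [inner_self_eq_norm_sq_to_K, hx]; simp
  rw [hcd]
  apply exists_eq_vecProj_of_periSpec (m := m)
  · rw [← hcd, ← h.periSpec_adjoint, hA, adjoint_vecProj, vecProj_eq_rankOne, periSpec_rankOne, hxx]
  · rw [← hcd, ← h.periSpec_eq, hA, adjoint_vecProj, vecProj_eq_rankOne,
      periSpec_mul_rankOne_pow_succ, rankOne_apply, hxx, one_smul, hxx, one_pow, one_mul]

theorem exists_eq_vecProj_of_map (h : IsPeriSpecPreserver A₁ m Ψ) (A : A₁) {y : K} (hy : ‖y‖ = 1)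
    (hA : Ψ A = vecProj y) : ∃ x : H, ‖x‖ = 1 ∧ (A : H →L[ℂ] H) = vecProj x := by
  obtain ⟨c, d, hcd⟩ := h.exists_eq_rankOne_of_map A hA
  have hyy : inner ℂ y y = 1 := by rw [inner_self_eq_norm_sq_to_K, hy]; simp
  rw [hcd]
  apply exists_eq_vecProj_of_periSpec (m := m)
  · rw [← hcd, h.periSpec_adjoint, hA, adjoint_vecProj, vecProj_eq_rankOne, periSpec_rankOne, hyy]
  · rw [← hcd, h.periSpec_eq, hA, adjoint_vecProj, vecProj_eq_rankOne,
      periSpec_mul_rankOne_pow_succ, rankOne_apply, hyy, one_smul, hyy, one_pow, one_mul]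

theorem exists_preimage_vecProj (h : IsPeriSpecPreserver A₁ m Ψ) {y : K} (hy : ‖y‖ = 1) :
    ∃ x : H, ‖x‖ = 1 ∧ Ψ ⟨rankOne ℂ x x, h.rankOne_mem x x⟩ = vecProj y := by
  obtain ⟨A, hA⟩ := h.exists_map_eq (vecProj y) ((rank_rankOne_le_one y y).trans one_le_two)
  obtain ⟨x, hx, hAx⟩ := h.exists_eq_vecProj_of_map A hy hA
  exact ⟨x, hx, by rw [← hA]; congr 1; exact Subtype.ext hAx.symm⟩

theorem inner_map_self (h : IsPeriSpecPreserver A₁ m Ψ) (A : A₁) {x : H} {y : K} (hx : ‖x‖ = 1)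
    (hy : ‖y‖ = 1) (hxy : Ψ ⟨rankOne ℂ x x, h.rankOne_mem x x⟩ = vecProj y) :
    inner ℂ (Ψ A y) y = inner ℂ ((A : H →L[ℂ] H) x) x := by
  have hxx : inner ℂ x x = 1 := by rw [inner_self_eq_norm_sq_to_K, hx]; simp
  have hyy : inner ℂ y y = 1 := by rw [inner_self_eq_norm_sq_to_K, hy]; simp
  have := h.periSpec_eq A ⟨rankOne ℂ x x, h.rankOne_mem x x⟩
  rw [hxy, vecProj_eq_rankOne, periSpec_mul_rankOne_pow_succ, periSpec_mul_rankOne_pow_succ, hxx,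
    hyy, one_pow, one_mul, one_mul, Set.singleton_eq_singleton_iff,
    adjoint_inner_right, adjoint_inner_right] at this
  exact this.symm

end IsPeriSpecPreserver

theorem ext_inner_map_unit {E : Type*} [NormedAddCommGroup E] [InnerProductSpace ℂ E]
    {S T : E →L[ℂ] E} (h : ∀ y : E, ‖y‖ = 1 → inner ℂ (S y) y = inner ℂ (T y) y) : S = T := by
  have := (ext_inner_map (S : E →ₗ[ℂ] E) (T : E →ₗ[ℂ] E)).mp fun z => by
    by_cases hz : z = 0
    · simp [hz]
    have hz' : (‖z‖ : ℂ) ≠ 0 := by simpa using hz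
    have := h ((‖z‖ : ℂ)⁻¹ • z) (by simp [norm_smul, hz])
    simp only [map_smul, inner_smul_left, inner_smul_right, map_inv₀, Complex.conj_ofReal] at this
    exact mul_left_cancel₀ (inv_ne_zero hz') (mul_left_cancel₀ (inv_ne_zero hz') this)
  ext z
  exact DFunLike.congr_fun this z

namespace IsPeriSpecPreserver

variable {A₁ : NonUnitalSubalgebra ℂ (H →L[ℂ] H)} {m : ℕ} {Ψ : A₁ → K →L[ℂ] K}
  [Nontrivial H] [Nontrivial K]

theorem map_add (h : IsPeriSpecPreserver A₁ m Ψ) (A B : A₁) : Ψ (A + B) = Ψ A + Ψ B := by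
  refine ext_inner_map_unit fun y hy => ?_
  obtain ⟨x, hx, hxy⟩ := h.exists_preimage_vecProj hy
  simp [h.inner_map_self _ hx hy hxy]

theorem map_smul (h : IsPeriSpecPreserver A₁ m Ψ) (c : ℂ) (A : A₁) : Ψ (c • A) = c • Ψ A := by
  refine ext_inner_map_unit fun y hy => ?_
  obtain ⟨x, hx, hxy⟩ := h.exists_preimage_vecProj hy
  simp [h.inner_map_self _ hx hy hxy]

/-- The image of `x ⊗ e` under `Ψ`, as a linear function of `x`. -/
noncomputable def column (h : IsPeriSpecPreserver A₁ m Ψ) (e : H) : H →ₗ[ℂ] K →L[ℂ] K where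
  toFun x := Ψ ⟨rankOne ℂ x e, h.rankOne_mem x e⟩
  map_add' x y := by
    rw [← h.map_add]
    congr 1
    ext z
    simp
  map_smul' c x := by
    rw [RingHom.id_apply, ← h.map_smul]
    congr 1
    ext z
    simp

end IsPeriSpecPreserver

/-- If adding `f ⊗ f` to `a ⊗ b` does not create an operator of rank two, then `a` or `b` is
proportional to `f`. -/
theorem rankOne_add_rankOne_self_dichotomy {E : Type*} [NormedAddCommGroup E]
    [InnerProductSpace ℂ E] {a b c d f : E} (hf : ‖f‖ = 1)
    (h : rankOne ℂ a b + rankOne ℂ f f = rankOne ℂ c d) :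
    (∀ z, rankOne ℂ a b z = inner ℂ f z • rankOne ℂ a b f) ∨
      ∀ z, rankOne ℂ a b z = inner ℂ f (rankOne ℂ a b z) • f := by
  have hff : inner ℂ f f = 1 := by rw [inner_self_eq_norm_sq_to_K, hf]; simp
  have hf0 : f ≠ 0 := by rintro rfl; simp at hf
  by_cases hb : ∃ w, inner ℂ f w = 0 ∧ inner ℂ b w ≠ 0
  · right
    obtain ⟨w, hfw, hbw⟩ := hb
    have h₁ := DFunLike.congr_fun h w
    have h₂ := DFunLike.congr_fun h f
    simp only [add_apply, rankOne_apply, hfw, zero_smul, add_zero, hff, one_smul] at h₁ h₂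
    have ha : a = ((inner ℂ b w)⁻¹ * inner ℂ d w) • c := by
      rw [mul_smul, ← h₁, inv_smul_smul₀ hbw]
    have hfc : f = (inner ℂ d f - inner ℂ b f * ((inner ℂ b w)⁻¹ * inner ℂ d w)) • c := by
      rw [sub_smul, mul_smul, ← ha, ← h₂]; abel
    obtain ⟨k, hk⟩ : ∃ k : ℂ, a = k • f := by
      generalize inner ℂ d f - inner ℂ b f * ((inner ℂ b w)⁻¹ * inner ℂ d w) = t at hfc
      have ht : t ≠ 0 := by rintro rfl; simp [hf0] at hfc
      refine ⟨((inner ℂ b w)⁻¹ * inner ℂ d w) * t⁻¹, ?_⟩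
      rw [mul_smul, (inv_smul_eq_iff₀ ht).mpr hfc, ← ha]
    intro z
    rw [hk, rankOne_apply, inner_smul_right, inner_smul_right, hff, smul_smul, mul_one]
  · left
    push Not at hb
    intro z
    have := hb (z - inner ℂ f z • f) (by rw [inner_sub_right, inner_smul_right, hff]; ring)
    rw [inner_sub_right, inner_smul_right, sub_eq_zero] at this
    rw [rankOne_apply, rankOne_apply, this, mul_smul]

theorem forall_or_forall_of_forall_or {E F : Type*} [AddCommGroup E] [Module ℂ E] [AddCommGroup F]
    [Module ℂ F] (f g : E →ₗ[ℂ] F) (h : ∀ x, f x = 0 ∨ g x = 0) :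
    (∀ x, f x = 0) ∨ ∀ x, g x = 0 := by
  by_contra! hcon
  obtain ⟨⟨x, hx⟩, y, hy⟩ := hcon
  have hx' := (h x).resolve_left hx
  have hy' := (h y).resolve_right hy
  rcases h (x + y) with h' | h' <;> simp_all

theorem vecProj_eq_of_norm_inner {E : Type*} [NormedAddCommGroup E] [InnerProductSpace ℂ E]
    {y z f : E} {t : ℝ} (ht : t ≠ 0) (hy : ‖y‖ = 1) (hz : ‖z‖ = 1)
    (h₁ : t = ‖(inner ℂ y f : ℂ)‖) (h₂ : t = ‖(inner ℂ y f : ℂ)‖ * ‖(inner ℂ y z : ℂ)‖) :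
    vecProj y = vecProj z := by
  have hyz : ‖(inner ℂ y z : ℂ)‖ = 1 := by
    rw [← h₁] at h₂
    exact (mul_eq_left₀ ht).mp h₂.symm
  have hy0 : y ≠ 0 := by rintro rfl; simp at hy
  have hz0 : z ≠ 0 := by rintro rfl; simp at hz
  obtain ⟨k, -, rfl⟩ := (norm_inner_eq_norm_iff (𝕜 := ℂ) hy0 hz0).mp (by rw [hyz, hy, hz, one_mul])
  rw [vecProj_smul]
  simpa [norm_smul, hy] using hz

namespace IsPeriSpecPreserver

variable {A₁ : NonUnitalSubalgebra ℂ (H →L[ℂ] H)} {m : ℕ} {Ψ : A₁ → K →L[ℂ] K}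
  [Nontrivial H] [Nontrivial K]

theorem norm_inner_eq (h : IsPeriSpecPreserver A₁ m Ψ) {e x : H} {f y : K} (he : ‖e‖ = 1)
    (hf : ‖f‖ = 1) (hef : Ψ ⟨rankOne ℂ e e, h.rankOne_mem e e⟩ = vecProj f)
    (hxy : Ψ ⟨rankOne ℂ x x, h.rankOne_mem x x⟩ = vecProj y) :
    ‖(inner ℂ x e : ℂ)‖ = ‖(inner ℂ y f : ℂ)‖ := by
  have := h.inner_map_self ⟨rankOne ℂ x x, h.rankOne_mem x x⟩ he hf hef
  rw [hxy, vecProj_eq_rankOne] at this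
  simp only [rankOne_apply, inner_smul_left, ← Complex.normSq_eq_conj_mul_self,
    Complex.normSq_eq_norm_sq] at this
  have h' : ‖(inner ℂ y f : ℂ)‖ ^ 2 = ‖(inner ℂ x e : ℂ)‖ ^ 2 := by exact_mod_cast this
  exact ((pow_left_inj₀ (norm_nonneg _) (norm_nonneg _) two_ne_zero).mp h').symm

theorem map_vecProj_of_column_left (h : IsPeriSpecPreserver A₁ m Ψ) {e x : H} {f z : K}
    (he : ‖e‖ = 1) (hf : ‖f‖ = 1) (hx : ‖x‖ = 1)
    (hef : Ψ ⟨rankOne ℂ e e, h.rankOne_mem e e⟩ = vecProj f) (hxe : inner ℂ x e ≠ 0)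
    (hz : Ψ ⟨rankOne ℂ x e, h.rankOne_mem x e⟩ = rankOne ℂ z f) :
    Ψ ⟨rankOne ℂ x x, h.rankOne_mem x x⟩ = vecProj z := by
  obtain ⟨y, hy, hxy⟩ := h.exists_map_eq_vecProj ⟨rankOne ℂ x x, h.rankOne_mem x x⟩ hx rfl
  have hee : inner ℂ e e = 1 := by rw [inner_self_eq_norm_sq_to_K, he]; simp
  have hff : inner ℂ f f = 1 := by rw [inner_self_eq_norm_sq_to_K, hf]; simp
  have hxx : inner ℂ x x = 1 := by rw [inner_self_eq_norm_sq_to_K, hx]; simp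
  have ht := h.periSpec_adjoint ⟨rankOne ℂ x e, h.rankOne_mem x e⟩
  have hn := h.periSpec_eq ⟨rankOne ℂ x e, h.rankOne_mem x e⟩ ⟨rankOne ℂ x e, h.rankOne_mem x e⟩
  have hv := h.periSpec_eq ⟨rankOne ℂ x x, h.rankOne_mem x x⟩ ⟨rankOne ℂ x e, h.rankOne_mem x e⟩
  rw [hz, adjoint_rankOne, adjoint_rankOne, periSpec_rankOne, periSpec_rankOne,
    Set.singleton_eq_singleton_iff] at ht
  have ht' : inner ℂ e x = inner ℂ f z := by rw [← inner_conj_symm, ht, inner_conj_symm]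
  have hex : inner ℂ e x ≠ 0 := fun h0 => hxe (inner_eq_zero_symm.mp h0)
  rw [hz, periSpec_mul_rankOne_pow_succ, periSpec_mul_rankOne_pow_succ,
    Set.singleton_eq_singleton_iff, ← ht', mul_right_inj' (pow_ne_zero _ hex), adjoint_rankOne,
    adjoint_rankOne, rankOne_apply, rankOne_apply, inner_smul_right, inner_smul_right, hee, hff,
    hxx, mul_one, mul_one, inner_self_eq_norm_sq_to_K] at hn
  rw [hz, hxy, periSpec_mul_rankOne_pow_succ, periSpec_mul_rankOne_pow_succ,
    Set.singleton_eq_singleton_iff, ← ht', mul_right_inj' (pow_ne_zero _ hex), adjoint_vecProj,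
    adjoint_rankOne, vecProj_eq_rankOne, rankOne_apply, rankOne_apply, inner_smul_right,
    inner_smul_right, hxx, one_mul] at hv
  have hz1 : ‖z‖ = 1 := by
    have : ‖z‖ ^ 2 = 1 := by
      apply Complex.ofReal_injective
      push_cast
      exact hn.symm
    exact (pow_eq_one_iff_of_nonneg (norm_nonneg z) two_ne_zero).mp this
  rw [hxy]
  refine vecProj_eq_of_norm_inner (norm_ne_zero_iff.mpr hxe) hy hz1
    (h.norm_inner_eq he hf hef hxy) ?_
  rw [norm_inner_symm, hv, norm_mul, norm_inner_symm f y, mul_comm]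

theorem map_vecProj_of_column_right (h : IsPeriSpecPreserver A₁ m Ψ) {e x : H} {f z : K}
    (he : ‖e‖ = 1) (hf : ‖f‖ = 1) (hx : ‖x‖ = 1)
    (hef : Ψ ⟨rankOne ℂ e e, h.rankOne_mem e e⟩ = vecProj f) (hxe : inner ℂ x e ≠ 0)
    (hz : Ψ ⟨rankOne ℂ x e, h.rankOne_mem x e⟩ = rankOne ℂ f z) :
    Ψ ⟨rankOne ℂ x x, h.rankOne_mem x x⟩ = vecProj z := by
  obtain ⟨y, hy, hxy⟩ := h.exists_map_eq_vecProj ⟨rankOne ℂ x x, h.rankOne_mem x x⟩ hx rfl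
  have hee : inner ℂ e e = 1 := by rw [inner_self_eq_norm_sq_to_K, he]; simp
  have hff : inner ℂ f f = 1 := by rw [inner_self_eq_norm_sq_to_K, hf]; simp
  have hxx : inner ℂ x x = 1 := by rw [inner_self_eq_norm_sq_to_K, hx]; simp
  have ht := h.periSpec_adjoint ⟨rankOne ℂ x e, h.rankOne_mem x e⟩
  have hn := h.periSpec_eq ⟨rankOne ℂ x e, h.rankOne_mem x e⟩ ⟨rankOne ℂ x e, h.rankOne_mem x e⟩
  have hv := h.periSpec_eq ⟨rankOne ℂ x x, h.rankOne_mem x x⟩ ⟨rankOne ℂ x e, h.rankOne_mem x e⟩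
  rw [hz, adjoint_rankOne, adjoint_rankOne, periSpec_rankOne, periSpec_rankOne,
    Set.singleton_eq_singleton_iff] at ht
  have ht' : inner ℂ e x = inner ℂ z f := by rw [← inner_conj_symm, ht, inner_conj_symm]
  have hex : inner ℂ e x ≠ 0 := fun h0 => hxe (inner_eq_zero_symm.mp h0)
  rw [hz, periSpec_mul_rankOne_pow_succ, periSpec_mul_rankOne_pow_succ,
    Set.singleton_eq_singleton_iff, ← ht', mul_right_inj' (pow_ne_zero _ hex), adjoint_rankOne,
    adjoint_rankOne, rankOne_apply, rankOne_apply, inner_smul_right, inner_smul_right, hee, hff,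
    hxx, mul_one, one_mul, inner_self_eq_norm_sq_to_K] at hn
  rw [hz, hxy, periSpec_mul_rankOne_pow_succ, periSpec_mul_rankOne_pow_succ,
    Set.singleton_eq_singleton_iff, ← ht', mul_right_inj' (pow_ne_zero _ hex), adjoint_vecProj,
    adjoint_rankOne, vecProj_eq_rankOne, rankOne_apply, rankOne_apply, inner_smul_right,
    inner_smul_right, hxx, one_mul] at hv
  have hz1 : ‖z‖ = 1 := by
    have : ‖z‖ ^ 2 = 1 := by
      apply Complex.ofReal_injective
      push_cast
      exact hn.symm
    exact (pow_eq_one_iff_of_nonneg (norm_nonneg z) two_ne_zero).mp this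
  rw [hxy]
  refine vecProj_eq_of_norm_inner (norm_ne_zero_iff.mpr hxe) hy hz1
    (h.norm_inner_eq he hf hef hxy) ?_
  rw [norm_inner_symm, hv, norm_mul, norm_inner_symm z y]

variable {σ σ' : ℂ →+* ℂ} [RingHomInvPair σ σ'] [RingHomInvPair σ' σ] [RingHomIsometric σ]

theorem map_rankOne_self_of_semilinear (h : IsPeriSpecPreserver A₁ m Ψ) (U : H →ₛₗ[σ] K) {e : H}
    (he : ‖e‖ = 1) (hU : ∀ x, ‖x‖ = 1 → inner ℂ x e ≠ 0 →
      Ψ ⟨rankOne ℂ x x, h.rankOne_mem x x⟩ = vecProj (U x)) (x : H) :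
    Ψ ⟨rankOne ℂ x x, h.rankOne_mem x x⟩ = rankOne ℂ (U x) (U x) := by
  have hne (x : H) (hx : inner ℂ x e ≠ 0) :
      Ψ ⟨rankOne ℂ x x, h.rankOne_mem x x⟩ = rankOne ℂ (U x) (U x) := by
    have hx0 : x ≠ 0 := by rintro rfl; simp at hx
    have hn : (‖x‖ : ℂ) ≠ 0 := by simpa using hx0
    set v := (‖x‖ : ℂ)⁻¹ • x with hv
    have hxv : x = (‖x‖ : ℂ) • v := (smul_inv_smul₀ hn x).symm
    have hUv := hU v (by simp [hv, norm_smul, hx0]) (by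
      rw [hv, inner_smul_left, map_inv₀, Complex.conj_ofReal]
      exact mul_ne_zero (inv_ne_zero hn) hx)
    have hσ : (starRingEnd ℂ) (σ ‖x‖) * σ ‖x‖ = (‖x‖ : ℂ) ^ 2 := by
      rw [← Complex.normSq_eq_conj_mul_self, Complex.normSq_eq_norm_sq, RingHomIsometric.norm_map]
      simp
    have : (⟨rankOne ℂ x x, h.rankOne_mem x x⟩ : A₁) =
        ((‖x‖ : ℂ) ^ 2) • ⟨rankOne ℂ v v, h.rankOne_mem v v⟩ := by
      apply Subtype.ext
      change rankOne ℂ x x = ((‖x‖ : ℂ) ^ 2) • rankOne ℂ v v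
      conv_lhs => rw [hxv]
      ext w
      simp only [rankOne_apply, smul_apply, inner_smul_left, smul_smul, Complex.conj_ofReal]
      congr 1
      ring
    have hUx : U x = σ ‖x‖ • U v := by
      conv_lhs => rw [hxv, U.map_smulₛₗ]
    rw [this, h.map_smul, hUv, hUx, vecProj_eq_rankOne]
    ext w
    simp only [rankOne_apply, smul_apply, inner_smul_left, smul_smul, ← hσ]
    congr 1
    ring
  by_cases hx : inner ℂ x e = 0
  · have h₁ := hne (x + e) (by simp [hx, he])
    have h₂ := hne (x - e) (by simp [hx, he])
    have h₃ := hne e (by simp [he])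
    have hsum : (⟨rankOne ℂ (x + e) (x + e), h.rankOne_mem _ _⟩ : A₁) +
        ⟨rankOne ℂ (x - e) (x - e), h.rankOne_mem _ _⟩ =
        (2 : ℂ) • ⟨rankOne ℂ x x, h.rankOne_mem x x⟩ +
          (2 : ℂ) • ⟨rankOne ℂ e e, h.rankOne_mem e e⟩ := by
      apply Subtype.ext
      change rankOne ℂ (x + e) (x + e) + rankOne ℂ (x - e) (x - e) =
        (2 : ℂ) • rankOne ℂ x x + (2 : ℂ) • rankOne ℂ e e
      simp only [_root_.map_add, map_sub, add_apply, sub_apply]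
      module
    have := congrArg Ψ hsum
    rw [h.map_add, h.map_add, h.map_smul, h.map_smul, h₁, h₂, h₃] at this
    simp only [_root_.map_add, map_sub, add_apply, sub_apply] at this
    refine smul_right_injective _ (two_ne_zero (α := ℂ)) ?_
    change (2 : ℂ) • _ = (2 : ℂ) • _
    rw [← add_left_inj ((2 : ℂ) • rankOne ℂ (U e) (U e)), ← this]
    module
  · exact hne x hx

theorem exists_isometryEquiv_of_semilinear (h : IsPeriSpecPreserver A₁ m Ψ) (U : H →ₛₗ[σ] K) {e : H}
    (he : ‖e‖ = 1) (hU : ∀ x, ‖x‖ = 1 → inner ℂ x e ≠ 0 →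
      Ψ ⟨rankOne ℂ x x, h.rankOne_mem x x⟩ = vecProj (U x)) :
    ∃ V : H ≃ₛₗᵢ[σ] K, ∀ x, Ψ ⟨rankOne ℂ x x, h.rankOne_mem x x⟩ = vecProj (V x) := by
  have hall := h.map_rankOne_self_of_semilinear U he hU
  have hnorm (x : H) : ‖U x‖ = ‖x‖ := by
    have := h.periSpec_adjoint ⟨rankOne ℂ x x, h.rankOne_mem x x⟩
    rw [hall, adjoint_rankOne, adjoint_rankOne, periSpec_rankOne, periSpec_rankOne,
      Set.singleton_eq_singleton_iff, inner_self_eq_norm_sq_to_K, inner_self_eq_norm_sq_to_K] at this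
    have h' : ‖x‖ ^ 2 = ‖U x‖ ^ 2 := by
      apply Complex.ofReal_injective
      push_cast
      exact this
    exact ((pow_left_inj₀ (norm_nonneg _) (norm_nonneg _) two_ne_zero).mp h').symm
  have hunit (y : K) (hy : ‖y‖ = 1) : ∃ x, U x = y := by
    obtain ⟨x, -, hxy⟩ := h.exists_preimage_vecProj hy
    rw [hall] at hxy
    have := DFunLike.congr_fun hxy y
    rw [vecProj_eq_rankOne, rankOne_apply, rankOne_apply, inner_self_eq_norm_sq_to_K, hy] at this
    refine ⟨σ' (inner ℂ (U x) y) • x, ?_⟩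
    rw [U.map_smulₛₗ, RingHomInvPair.comp_apply_eq₂, this]
    simp
  have hsurj : Function.Surjective U := fun y => by
    by_cases hy : y = 0
    · exact ⟨0, by simp [hy]⟩
    have hn : (‖y‖ : ℂ) ≠ 0 := by simpa using hy
    obtain ⟨x, hx⟩ := hunit ((‖y‖ : ℂ)⁻¹ • y) (by simp [norm_smul, hy])
    refine ⟨σ' ‖y‖ • x, ?_⟩
    rw [U.map_smulₛₗ, RingHomInvPair.comp_apply_eq₂, hx, smul_inv_smul₀ hn]
  exact ⟨LinearIsometryEquiv.ofSurjective ⟨U, hnorm⟩ hsurj, hall⟩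

theorem exists_unitary_or_antiunitary (h : IsPeriSpecPreserver A₁ m Ψ) :
    (∃ V : H ≃ₗᵢ[ℂ] K, ∀ x, Ψ ⟨rankOne ℂ x x, h.rankOne_mem x x⟩ = vecProj (V x)) ∨
      ∃ V : H ≃ₛₗᵢ[starRingEnd ℂ] K, ∀ x,
        Ψ ⟨rankOne ℂ x x, h.rankOne_mem x x⟩ = vecProj (V x) := by
  obtain ⟨e, he⟩ := exists_norm_eq H zero_le_one
  obtain ⟨f, hf, hef⟩ := h.exists_map_eq_vecProj ⟨rankOne ℂ e e, h.rankOne_mem e e⟩ he rfl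
  set G := h.column e with hG
  have hGe : G e = rankOne ℂ f f := hef
  let F₁ : H →ₗ[ℂ] K →L[ℂ] K :=
    { toFun := fun x => G x - rankOne ℂ (G x f) f
      map_add' := fun x y => by simp only [_root_.map_add, add_apply]; abel
      map_smul' := fun c x => by
        simp only [_root_.map_smul, smul_apply, RingHom.id_apply, smul_sub] }
  let F₂ : H →ₗ[ℂ] K →L[ℂ] K :=
    { toFun := fun x => G x - rankOne ℂ f f * G x
      map_add' := fun x y => by simp only [_root_.map_add, mul_add]; abel
      map_smul' := fun c x => by
        simp only [_root_.map_smul, mul_smul_comm, RingHom.id_apply, smul_sub] }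
  have hdich (x : H) : F₁ x = 0 ∨ F₂ x = 0 := by
    obtain ⟨a, b, hab⟩ := h.exists_map_eq_rankOne ⟨rankOne ℂ x e, h.rankOne_mem x e⟩ rfl
    obtain ⟨c, d, hcd⟩ :=
      h.exists_map_eq_rankOne ⟨rankOne ℂ (x + e) e, h.rankOne_mem (x + e) e⟩ rfl
    have hab' : G x = rankOne ℂ a b := hab
    have hcd' : G (x + e) = rankOne ℂ c d := hcd
    rw [_root_.map_add, hGe, hab'] at hcd'
    refine (rankOne_add_rankOne_self_dichotomy hf hcd').imp (fun hz => ?_) fun hz => ?_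
    · ext z
      change G x z - inner ℂ f z • G x f = 0
      rw [hab', hz z, sub_self]
    · ext z
      change G x z - inner ℂ f (G x z) • f = 0
      rw [hab', ← hz z, sub_self]
  refine (forall_or_forall_of_forall_or F₁ F₂ hdich).imp (fun hF => ?_) fun hF => ?_
  · let U : H →ₗ[ℂ] K :=
      { toFun := fun x => G x f
        map_add' := by simp
        map_smul' := by simp }
    exact h.exists_isometryEquiv_of_semilinear U he fun x hx hxe =>
      h.map_vecProj_of_column_left he hf hx hef hxe (sub_eq_zero.mp (hF x))
  · let U : H →ₛₗ[starRingEnd ℂ] K :=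
      { toFun := fun x => adjoint (G x) f
        map_add' := by simp
        map_smul' := fun c x => by
          rw [_root_.map_smul, LinearIsometryEquiv.map_smulₛₗ, smul_apply] }
    refine h.exists_isometryEquiv_of_semilinear U he fun x hx hxe =>
      h.map_vecProj_of_column_right he hf hx hef hxe ?_
    have := sub_eq_zero.mp (hF x)
    change G x = rankOne ℂ f (adjoint (G x) f)
    conv_lhs => rw [this]
    ext z
    simp [adjoint_inner_left]

end IsPeriSpecPreserver

end Preserver

/-- Claim 3 in the proof of Theorem 3.2: if `Φ` is a map between standard operator algebras
on complex Hilbert spaces with `I ∈ A₁`, whose range contains all operators of rank at most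
two, which satisfies `σ_π(B^r A* B^s) = σ_π(Φ(B)^r Φ(A)* Φ(B)^s)` for all `A, B ∈ A₁`
(`r + s ≥ 1`), and which satisfies `Φ(I) = I`, then `Φ` preserves rank-one projections in
both directions and there is a unitary or conjugate-unitary `U : H → K` with
`Φ(x ⊗ x) = (Ux) ⊗ (Ux)` for every unit vector `x ∈ H`. -/
theorem periSpec_skew_sandwich_preserver_projections {H K : Type*}
    [NormedAddCommGroup H] [InnerProductSpace ℂ H] [CompleteSpace H]
    [NormedAddCommGroup K] [InnerProductSpace ℂ K] [CompleteSpace K]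
    (A₁ : NonUnitalSubalgebra ℂ (H →L[ℂ] H))
    (A₂ : NonUnitalSubalgebra ℂ (K →L[ℂ] K))
    (hA₁ : ∀ T : H →L[ℂ] H, LinearMap.rank (T : H →ₗ[ℂ] H) < Cardinal.aleph0 → T ∈ A₁)
    (hA₂ : ∀ T : K →L[ℂ] K, LinearMap.rank (T : K →ₗ[ℂ] K) < Cardinal.aleph0 → T ∈ A₂)
    (hI : (1 : H →L[ℂ] H) ∈ A₁)
    (r s : ℕ) (hrs : 1 ≤ r + s)
    (Φ : A₁ → A₂)
    (hrange : ∀ T : K →L[ℂ] K, LinearMap.rank (T : K →ₗ[ℂ] K) ≤ 2 →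
      ∃ A : A₁, (Φ A : K →L[ℂ] K) = T)
    (hpres : ∀ A B : A₁,
      periSpec ((B : H →L[ℂ] H) ^ r
          * ContinuousLinearMap.adjoint (A : H →L[ℂ] H) * (B : H →L[ℂ] H) ^ s)
        = periSpec ((Φ B : K →L[ℂ] K) ^ r
            * ContinuousLinearMap.adjoint (Φ A : K →L[ℂ] K) * (Φ B : K →L[ℂ] K) ^ s))
    (hone : (Φ ⟨1, hI⟩ : K →L[ℂ] K) = 1) :
    (∀ P : A₁, IsRankOneProjection (P : H →L[ℂ] H)
        ↔ IsRankOneProjection (Φ P : K →L[ℂ] K)) ∧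
    (∀ Q : K →L[ℂ] K, IsRankOneProjection Q →
        ∃ P : A₁, IsRankOneProjection (P : H →L[ℂ] H) ∧ (Φ P : K →L[ℂ] K) = Q) ∧
    ((∃ U : H ≃ₗᵢ[ℂ] K, ∀ (x : H), ‖x‖ = 1 → ∀ (h : vecProj x ∈ A₁),
        (Φ ⟨vecProj x, h⟩ : K →L[ℂ] K) = vecProj (U x)) ∨
     (∃ U : H ≃ₛₗᵢ[starRingEnd ℂ] K, ∀ (x : H), ‖x‖ = 1 → ∀ (h : vecProj x ∈ A₁),
        (Φ ⟨vecProj x, h⟩ : K →L[ℂ] K) = vecProj (U x))) := by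
  rcases subsingleton_or_nontrivial H with hH | hH
  · have hK : Subsingleton K := by
      obtain ⟨A, hA⟩ := hrange 0 (by simp [LinearMap.rank_zero])
      rw [Subsingleton.elim A ⟨1, hI⟩, hone] at hA
      exact subsingleton_of_forall_eq 0 fun y => DFunLike.congr_fun hA y
    refine ⟨fun P => ?_, fun Q hQ => ?_, Or.inl ⟨⟨0, fun x => by simp [Subsingleton.elim x 0]⟩, ?_⟩⟩
    · simp [isRankOneProjection_iff, Subsingleton.elim _ (0 : H), Subsingleton.elim _ (0 : K)]
    · obtain ⟨y, hy, -⟩ := (isRankOneProjection_iff Q).mp hQ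
      simp [Subsingleton.elim y 0] at hy
    · intro x hx
      simp [Subsingleton.elim x 0] at hx
  have hK : Nontrivial K := by
    by_contra hK
    rw [not_nontrivial_iff_subsingleton] at hK
    obtain ⟨z, hz, hzr⟩ := spectrum.exists_nnnorm_eq_spectralRadius
      ((1 : H →L[ℂ] H) ^ r * adjoint (1 : H →L[ℂ] H) * (1 : H →L[ℂ] H) ^ s)
    have hmem := (hpres ⟨1, hI⟩ ⟨1, hI⟩).subset ⟨hz, hzr⟩
    exact (spectrum.of_subsingleton (R := ℂ) _).subset hmem.1
  obtain ⟨m, hm⟩ := Nat.exists_eq_add_of_le' hrs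
  have h : IsPeriSpecPreserver A₁ m fun A => (Φ A : K →L[ℂ] K) :=
    { mem_of_rank_lt := hA₁
      one_mem := hI
      exists_map_eq := hrange
      periSpec_eq := fun A B => by
        rw [← hm, ← periSpec_pow_mul_mul_pow, ← periSpec_pow_mul_mul_pow, hpres]
      map_one := hone }
  refine ⟨fun P => ?_, fun Q hQ => ?_, ?_⟩
  · rw [isRankOneProjection_iff, isRankOneProjection_iff]
    exact ⟨fun ⟨_, hx, hP⟩ => h.exists_map_eq_vecProj P hx hP,
      fun ⟨_, hy, hP⟩ => h.exists_eq_vecProj_of_map P hy hP⟩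
  · obtain ⟨y, hy, rfl⟩ := (isRankOneProjection_iff Q).mp hQ
    obtain ⟨x, hx, hxy⟩ := h.exists_preimage_vecProj hy
    exact ⟨_, (isRankOneProjection_iff _).mpr ⟨x, hx, rfl⟩, hxy⟩
  · exact h.exists_unitary_or_antiunitary.imp (fun ⟨V, hV⟩ => ⟨V, fun x _ _ => hV x⟩)
      fun ⟨V, hV⟩ => ⟨V, fun x _ _ => hV x⟩
end
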